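/- arXiv:1901.05097 — 6 statements merged into one kernel-verified Lean document; each statement's English description precedes it below -/
import Mathlib

section
/- Let h > 0, i > 0, a ≥ 0, k ≥ 0 and δ > 0 be real constants. Then the function (μ₁, μ₂) ↦ (h·i·μ₁·μ₂)/(δ·h·i·μ₁·μ₂ + a·i·μ₂ + k·μ₁ + 1) tends to 1/δ along the filter atTop ×ˢ atTop (i.e., as μ₁ → ∞ and μ₂ → ∞ simultaneously). -/
open Filter

theorem sndr_tendsto_ceiling (h i a k δ : ℝ) (hh : 0 < h) (hi : 0 < i)
    (ha : 0 ≤ a) (hk : 0 ≤ k) (hδ : 0 < δ) :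
    Tendsto
      (fun p : ℝ × ℝ =>
        h * i * p.1 * p.2 / (δ * (h * i * p.1 * p.2) + a * i * p.2 + k * p.1 + 1))
      (atTop ×ˢ atTop) (nhds (1 / δ)) := by
  have inv_fst : Tendsto (fun p : ℝ × ℝ => p.1⁻¹) (atTop ×ˢ atTop) (nhds 0) :=
    tendsto_inv_atTop_zero.comp tendsto_fst
  have inv_snd : Tendsto (fun p : ℝ × ℝ => p.2⁻¹) (atTop ×ˢ atTop) (nhds 0) :=
    tendsto_inv_atTop_zero.comp tendsto_snd
  have denom_tendsto : Tendsto
      (fun p : ℝ × ℝ => δ + a / h * p.1⁻¹ + k / (h * i) * p.2⁻¹ + 1 / (h * i) * (p.1⁻¹ * p.2⁻¹))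
      (atTop ×ˢ atTop) (nhds δ) := by
    simpa using ((inv_fst.const_mul (a / h)).const_add δ).add (inv_snd.const_mul (k / (h * i)))
      |>.add ((inv_fst.mul inv_snd).const_mul (1 / (h * i)))
  have inv_tendsto := denom_tendsto.inv₀ hδ.ne'
  rw [one_div]
  refine inv_tendsto.congr' ?_
  filter_upwards [tendsto_fst.eventually (eventually_gt_atTop (0 : ℝ)),
    tendsto_snd.eventually (eventually_gt_atTop (0 : ℝ))] with p hx hy
  have numer_pos : 0 < h * i * p.1 * p.2 := by positivity
  have denom_eq : δ * (h * i * p.1 * p.2) + a * i * p.2 + k * p.1 + 1 =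
      h * i * p.1 * p.2 *
        (δ + a / h * p.1⁻¹ + k / (h * i) * p.2⁻¹ + 1 / (h * i) * (p.1⁻¹ * p.2⁻¹)) := by
    field_simp
  rw [denom_eq, div_mul_cancel_left₀ numer_pos.ne']
end

section
/- Let h > 0, i > 0, a ≥ 0 and k ≥ 0 be real constants. Then the function (μ₁, μ₂) ↦ (h·i·μ₁·μ₂)/(a·i·μ₂ + k·μ₁ + 1) tends to ∞ (atTop) along the filter atTop ×ˢ atTop (i.e., as μ₁ → ∞ and μ₂ → ∞ simultaneously). -/
open Filter

theorem tendsto_min_atTop_prod_atTop {α : Type*} [LinearOrder α] :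
    Tendsto (fun p : α × α => min p.1 p.2) (atTop ×ˢ atTop) atTop :=
  tendsto_atTop.2 fun b => by
    filter_upwards [tendsto_fst.eventually (eventually_ge_atTop b),
      tendsto_snd.eventually (eventually_ge_atTop b)] with p h₁ h₂
    exact le_min h₁ h₂

theorem div_mul_min_le_mul_div {c A B x y : ℝ} (hc : 0 ≤ c) (hA : 0 ≤ A) (hB : 0 ≤ B)
    (hx : 1 ≤ x) (hy : 1 ≤ y) :
    c / (A + B + 1) * min x y ≤ c * x * y / (A * y + B * x + 1) := by
  have hmx : min x y ≤ x := min_le_left x y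
  have hmy : min x y ≤ y := min_le_right x y
  have h₁ : min x y * y ≤ x * y := by gcongr
  have h₂ : min x y * x ≤ x * y := by rw [mul_comm x y]; gcongr
  have h₃ : min x y ≤ x * y := by nlinarith
  have key : min x y * (A * y + B * x + 1) ≤ x * y * (A + B + 1) := by
    linarith [mul_le_mul_of_nonneg_left h₁ hA, mul_le_mul_of_nonneg_left h₂ hB]
  rw [div_mul_eq_mul_div, div_le_div_iff₀ (by positivity) (by positivity)]
  linarith [mul_le_mul_of_nonneg_left key hc]

theorem sndr_ideal_tendsto_atTop (h i a k : ℝ) (hh : 0 < h) (hi : 0 < i)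
    (ha : 0 ≤ a) (hk : 0 ≤ k) :
    Tendsto
      (fun p : ℝ × ℝ => h * i * p.1 * p.2 / (a * i * p.2 + k * p.1 + 1))
      (atTop ×ˢ atTop) atTop := by
  have hc : 0 < h * i / (a * i + k + 1) := by positivity
  refine tendsto_atTop_mono' _ ?_ (tendsto_min_atTop_prod_atTop.const_mul_atTop hc)
  filter_upwards [tendsto_fst.eventually (eventually_ge_atTop 1),
    tendsto_snd.eventually (eventually_ge_atTop 1)] with p h₁ h₂
  exact div_mul_min_le_mul_div (by positivity) (by positivity) hk h₁ h₂
end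

section
/- Let (Ω, P) be a probability space and let H, I : Ω → ℝ be measurable functions that are strictly positive almost surely. Let a ≥ 0, k ≥ 0 and δ > 0 be real constants, and for μ₁, μ₂ > 0 define γ(μ₁,μ₂)(ω) = (H(ω)·I(ω)·μ₁·μ₂)/(δ·H(ω)·I(ω)·μ₁·μ₂ + a·I(ω)·μ₂ + k·μ₁ + 1). Then the function (μ₁, μ₂) ↦ (1/2)·log₂(1 + ∫ γ(μ₁,μ₂) dP) tends to (1/2)·log₂(1 + 1/δ) along the filter atTop ×ˢ atTop. -/
open Filter MeasureTheory

theorem tendsto_sndr_ceiling {h i a k δ : ℝ} (hh : 0 < h) (hi : 0 < i) (hδ : 0 < δ) :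
    Tendsto (fun p : ℝ × ℝ => h * i * p.1 * p.2 /
      (δ * (h * i * p.1 * p.2) + a * i * p.2 + k * p.1 + 1))
      (atTop ×ˢ atTop) (nhds (1 / δ)) := by
  have hx : Tendsto (fun p : ℝ × ℝ => p.1⁻¹) (atTop ×ˢ atTop) (nhds 0) :=
    tendsto_inv_atTop_zero.comp tendsto_fst
  have hy : Tendsto (fun p : ℝ × ℝ => p.2⁻¹) (atTop ×ˢ atTop) (nhds 0) :=
    tendsto_inv_atTop_zero.comp tendsto_snd
  have hden : Tendsto (fun p : ℝ × ℝ =>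
      δ * (h * i) + a * i * p.1⁻¹ + k * p.2⁻¹ + p.1⁻¹ * p.2⁻¹)
      (atTop ×ˢ atTop) (nhds (δ * (h * i))) := by
    simpa using ((((hx.const_mul (a * i)).const_add (δ * (h * i))).add
      (hy.const_mul k)).add (hx.mul hy))
  have hlim := (tendsto_const_nhds (x := h * i)).div hden (by positivity)
  rw [show h * i / (δ * (h * i)) = 1 / δ by field_simp] at hlim
  refine hlim.congr' ?_
  filter_upwards [tendsto_fst.eventually (eventually_gt_atTop (0 : ℝ)),
    tendsto_snd.eventually (eventually_gt_atTop (0 : ℝ))] with p hp₁ hp₂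
  have hp : p.1 * p.2 ≠ 0 := by positivity
  rw [Pi.div_apply, ← mul_div_mul_right _ _ hp]
  congr 1
  · ring
  · field_simp

theorem norm_sndr_le_ceiling {h i a k δ x y : ℝ} (hh : 0 < h) (hi : 0 < i) (ha : 0 ≤ a)
    (hk : 0 ≤ k) (hδ : 0 < δ) (hx : 0 < x) (hy : 0 < y) :
    ‖h * i * x * y / (δ * (h * i * x * y) + a * i * y + k * x + 1)‖ ≤ 1 / δ := by
  rw [Real.norm_of_nonneg (by positivity), div_le_div_iff₀ (by positivity) hδ]
  have h₁ : 0 ≤ a * i * y := by positivity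
  have h₂ : 0 ≤ k * x := by positivity
  linarith

theorem ergodic_capacity_tendsto_ceiling {Ω : Type*} [MeasurableSpace Ω]
    (P : Measure Ω) [IsProbabilityMeasure P]
    (H I : Ω → ℝ) (hHm : Measurable H) (hIm : Measurable I)
    (hHpos : ∀ᵐ ω ∂P, 0 < H ω) (hIpos : ∀ᵐ ω ∂P, 0 < I ω)
    (a k δ : ℝ) (ha : 0 ≤ a) (hk : 0 ≤ k) (hδ : 0 < δ) :
    Tendsto
      (fun p : ℝ × ℝ =>
        (1 / 2) * Real.logb 2
          (1 + ∫ ω, H ω * I ω * p.1 * p.2 /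
            (δ * (H ω * I ω * p.1 * p.2) + a * I ω * p.2 + k * p.1 + 1) ∂P))
      (atTop ×ˢ atTop) (nhds ((1 / 2) * Real.logb 2 (1 + 1 / δ))) := by
  have hint : Tendsto (fun p : ℝ × ℝ => ∫ ω, H ω * I ω * p.1 * p.2 /
      (δ * (H ω * I ω * p.1 * p.2) + a * I ω * p.2 + k * p.1 + 1) ∂P)
      (atTop ×ˢ atTop) (nhds (∫ _, 1 / δ ∂P)) := by
    refine tendsto_integral_filter_of_dominated_convergence (fun _ => 1 / δ) ?_ ?_
      (integrable_const _) ?_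
    · exact Eventually.of_forall fun p => Measurable.aestronglyMeasurable (by fun_prop)
    · filter_upwards [tendsto_fst.eventually (eventually_gt_atTop (0 : ℝ)),
        tendsto_snd.eventually (eventually_gt_atTop (0 : ℝ))] with p hp₁ hp₂
      filter_upwards [hHpos, hIpos] with ω hH hI
      exact norm_sndr_le_ceiling hH hI ha hk hδ hp₁ hp₂
    · filter_upwards [hHpos, hIpos] with ω hH hI
      exact tendsto_sndr_ceiling hH hI hδ
  rw [integral_const, probReal_univ, one_smul] at hint
  have hne : 1 + 1 / δ ≠ 0 := by positivity
  exact (((hint.const_add 1).log hne).div_const (Real.log 2)).const_mul (1 / 2)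
end

section
/- Let N, m be natural numbers with 1 ≤ m ≤ N, let μ₁ > 0 and 0 ≤ ρ ≤ 1, and define f(t) = m·C(N,m)·Σ_{n=0}^{m−1} C(m−1,n)·((−1)ⁿ/μ₁)·(1/((N−m+n)(1−ρ)+1))·exp(−(N−m+n+1)·t/(((N−m+n)(1−ρ)+1)·μ₁)). Then for every x ≥ 0, ∫₀ˣ f(t) dt = 1 − m·C(N,m)·Σ_{n=0}^{m−1} ((−1)ⁿ·C(m−1,n)/(N−m+n+1))·exp(−(N−m+n+1)·x/(((N−m+n)(1−ρ)+1)·μ₁)). -/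
open Finset

/-- The alternating binomial sum representing the Beta function at positive integers. -/
theorem sum_neg_one_pow_mul_choose_div (k a : ℕ) :
    ∑ n ∈ Finset.range (k + 1), (-1 : ℝ) ^ n * (k.choose n : ℝ) / ((a : ℝ) + n + 1) =
      (a.factorial : ℝ) * k.factorial / (a + k + 1).factorial := by
  induction k generalizing a with
  | zero =>
    have h : (a.factorial : ℝ) ≠ 0 := by exact_mod_cast a.factorial_ne_zero
    have h' : (a : ℝ) + 1 ≠ 0 := by positivity
    simp [Nat.factorial_succ]
    field_simp
  | succ k ih =>
    have pascal := Finset.sum_choose_succ_mul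
      (fun i _ => (-1 : ℝ) ^ i / ((a : ℝ) + i + 1)) k
    have recurrence :
        ∑ n ∈ Finset.range (k + 1 + 1),
            (-1 : ℝ) ^ n * ((k + 1).choose n : ℝ) / ((a : ℝ) + n + 1) =
          ∑ n ∈ Finset.range (k + 1), (-1 : ℝ) ^ n * (k.choose n : ℝ) / ((a : ℝ) + n + 1) -
          ∑ n ∈ Finset.range (k + 1),
            (-1 : ℝ) ^ n * (k.choose n : ℝ) / (((a + 1 : ℕ) : ℝ) + n + 1) := by
      rw [sub_eq_add_neg, ← Finset.sum_neg_distrib]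
      convert pascal using 2
      · ring
      · exact Finset.sum_congr rfl fun n _ => by ring
      · exact Finset.sum_congr rfl fun n _ => by push_cast; ring
    rw [recurrence, ih, ih, show a + 1 + k + 1 = a + k + 1 + 1 by ring,
      show a + (k + 1) + 1 = a + k + 1 + 1 by ring]
    have h : ((a + k + 1).factorial : ℝ) ≠ 0 := by
      exact_mod_cast (a + k + 1).factorial_ne_zero
    have h' : (a : ℝ) + k + 1 + 1 ≠ 0 := by positivity
    rw [Nat.factorial_succ (a + k + 1), Nat.factorial_succ a, Nat.factorial_succ k]
    push_cast
    field_simp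
    ring

theorem mul_choose_mul_sum_neg_one_pow_mul_choose_div (N m : ℕ) (hm : 1 ≤ m) (hmN : m ≤ N) :
    (m : ℝ) * (N.choose m : ℝ) * ∑ n ∈ Finset.range m,
      (-1 : ℝ) ^ n * ((m - 1).choose n : ℝ) / ((N : ℝ) - m + n + 1) = 1 := by
  obtain ⟨k, rfl⟩ := Nat.exists_eq_add_of_le' hm
  obtain ⟨a, rfl⟩ := Nat.exists_eq_add_of_le' hmN
  have hsub : ((a + (k + 1) : ℕ) : ℝ) - ((k + 1 : ℕ) : ℝ) = a := by push_cast; ring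
  rw [hsub, Nat.add_sub_cancel, sum_neg_one_pow_mul_choose_div, ← add_assoc]
  have h := Nat.choose_mul_factorial_mul_factorial (show k + 1 ≤ a + k + 1 by omega)
  rw [show a + k + 1 - (k + 1) = a by omega, Nat.factorial_succ k] at h
  have h' : ((a + k + 1).factorial : ℝ) ≠ 0 := by
    exact_mod_cast (a + k + 1).factorial_ne_zero
  rw [mul_div_assoc', div_eq_one_iff_eq h', ← h]
  push_cast
  ring

theorem integral_exp_neg_mul_div {b c : ℝ} (hb : b ≠ 0) (hc : c ≠ 0) (x : ℝ) :
    ∫ t in (0 : ℝ)..x, Real.exp (-(b * t) / c) = c / b * (1 - Real.exp (-(b * x) / c)) := by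
  have hderiv (t : ℝ) :
      HasDerivAt (fun t => -(c / b) * Real.exp (-(b * t) / c)) (Real.exp (-(b * t) / c)) t := by
    have h := ((((hasDerivAt_id t).const_mul b).neg.div_const c).exp).const_mul (-(c / b))
    refine h.congr_deriv ?_
    simp only [id, Pi.neg_apply]
    field_simp
  rw [intervalIntegral.integral_eq_sub_of_hasDerivAt (fun t _ => hderiv t)
    (Continuous.intervalIntegrable (by fun_prop) _ _)]
  simp
  ring

theorem prs_snr_cdf (N m : ℕ) (hm : 1 ≤ m) (hmN : m ≤ N)
    (μ₁ ρ : ℝ) (hμ : 0 < μ₁) (hρ0 : 0 ≤ ρ) (hρ1 : ρ ≤ 1)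
    (f : ℝ → ℝ)
    (hf : ∀ t, f t = (m : ℝ) * (N.choose m : ℝ) *
      ∑ n ∈ Finset.range m,
        ((m - 1).choose n : ℝ) * ((-1 : ℝ) ^ n / μ₁) *
          (1 / (((N : ℝ) - (m : ℝ) + (n : ℝ)) * (1 - ρ) + 1)) *
          Real.exp (-(((N : ℝ) - (m : ℝ) + (n : ℝ) + 1) * t) /
            ((((N : ℝ) - (m : ℝ) + (n : ℝ)) * (1 - ρ) + 1) * μ₁)))
    (x : ℝ) (hx : 0 ≤ x) :
    ∫ t in (0 : ℝ)..x, f t =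
      1 - (m : ℝ) * (N.choose m : ℝ) *
        ∑ n ∈ Finset.range m,
          ((-1 : ℝ) ^ n * ((m - 1).choose n : ℝ) / ((N : ℝ) - (m : ℝ) + (n : ℝ) + 1)) *
            Real.exp (-(((N : ℝ) - (m : ℝ) + (n : ℝ) + 1) * x) /
              ((((N : ℝ) - (m : ℝ) + (n : ℝ)) * (1 - ρ) + 1) * μ₁)) := by
  have hNm : (0 : ℝ) ≤ (N : ℝ) - m := sub_nonneg.mpr (by exact_mod_cast hmN)
  have hρ : 0 ≤ 1 - ρ := sub_nonneg.mpr hρ1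
  simp only [hf]
  rw [intervalIntegral.integral_const_mul, intervalIntegral.integral_finsetSum fun n _ =>
    Continuous.intervalIntegrable (by fun_prop) _ _]
  refine Eq.trans ?_ (congrArg (· - _)
    (mul_choose_mul_sum_neg_one_pow_mul_choose_div N m hm hmN))
  rw [← mul_sub, ← Finset.sum_sub_distrib]
  congr 1
  refine Finset.sum_congr rfl fun n _ => ?_
  have hb : (N : ℝ) - m + n + 1 ≠ 0 := by positivity
  have hd : ((N : ℝ) - m + n) * (1 - ρ) + 1 ≠ 0 := by positivity
  rw [intervalIntegral.integral_const_mul,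
    integral_exp_neg_mul_div hb (mul_ne_zero hd hμ.ne')]
  generalize Real.exp _ = e
  generalize ((N : ℝ) - m + n) * (1 - ρ) + 1 = d at *
  field_simp
end

section
/- Let (Ω, P) be a probability space, δ > 0 a real constant, and Θ : Ω → ℝ an integrable random variable with Θ ≥ 0 almost surely. Then E[ (1/2)·log₂(1 + Θ/(δΘ + 1)) ] ≤ (1/2)·log₂(1 + E[Θ]/(δ·E[Θ] + 1)). -/
open MeasureTheory

/-- On the nonnegative half-line, the concave function `x ↦ log (1 + x / (δ x + 1))` lies below
its tangent line at any `m ≥ 0`. -/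
lemma log_one_add_div_le_tangent {δ m x : ℝ} (hδ : 0 ≤ δ) (hm : 0 ≤ m) (hx : 0 ≤ x) :
    Real.log (1 + x / (δ * x + 1)) ≤ Real.log (1 + m / (δ * m + 1)) +
      (x - m) / ((δ * m + 1) ^ 2 * (1 + m / (δ * m + 1))) := by
  have hdm : 0 < δ * m + 1 := by positivity
  have hdx : 0 < δ * x + 1 := by positivity
  have hum : 0 < 1 + m / (δ * m + 1) := by positivity
  have hux : 0 < 1 + x / (δ * x + 1) := by positivity
  have hlog := Real.log_le_sub_one_of_pos (div_pos hux hum)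
  rw [Real.log_div hux.ne' hum.ne', div_sub_one hum.ne'] at hlog
  have hfrac : 1 + x / (δ * x + 1) - (1 + m / (δ * m + 1)) ≤ (x - m) / (δ * m + 1) ^ 2 := by
    have hgap : (x - m) / (δ * m + 1) ^ 2 - (1 + x / (δ * x + 1) - (1 + m / (δ * m + 1))) =
        δ * (x - m) ^ 2 / ((δ * m + 1) ^ 2 * (δ * x + 1)) := by
      field_simp
      ring
    have : 0 ≤ δ * (x - m) ^ 2 / ((δ * m + 1) ^ 2 * (δ * x + 1)) := by positivity
    linarith
  have hdiv := div_le_div_of_nonneg_right hfrac hum.le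
  rw [div_div] at hdiv
  linarith

theorem ergodic_capacity_upper_bound {Ω : Type*} [MeasurableSpace Ω]
    (P : Measure Ω) [IsProbabilityMeasure P]
    (δ : ℝ) (hδ : 0 < δ)
    (Θ : Ω → ℝ) (hInt : Integrable Θ P) (hpos : ∀ᵐ ω ∂P, 0 ≤ Θ ω) :
    ∫ ω, (1 / 2) * Real.logb 2 (1 + Θ ω / (δ * Θ ω + 1)) ∂P ≤
      (1 / 2) * Real.logb 2
        (1 + (∫ ω, Θ ω ∂P) / (δ * (∫ ω, Θ ω ∂P) + 1)) := by
  have hm : 0 ≤ ∫ ω, Θ ω ∂P := integral_nonneg_of_ae hpos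
  set m := ∫ ω, Θ ω ∂P with hm_def
  have hlog2 : 0 < Real.log 2 := Real.log_pos one_lt_two
  simp only [Real.logb, integral_const_mul, integral_div]
  gcongr
  set d := (δ * m + 1) ^ 2 * (1 + m / (δ * m + 1))
  have hcenter : Integrable (fun ω ↦ (Θ ω - m) / d) P :=
    (hInt.sub (integrable_const m)).div_const d
  calc ∫ ω, Real.log (1 + Θ ω / (δ * Θ ω + 1)) ∂P
      ≤ ∫ ω, (Real.log (1 + m / (δ * m + 1)) + (Θ ω - m) / d) ∂P := by
        refine integral_mono_of_nonneg ?_ ((integrable_const _).add hcenter) ?_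
        · filter_upwards [hpos] with ω hω
          exact Real.log_nonneg (le_add_of_nonneg_right (by positivity))
        · filter_upwards [hpos] with ω hω
          exact log_one_add_div_le_tangent hδ.le hm hω
    _ = Real.log (1 + m / (δ * m + 1)) := by
        rw [integral_add (integrable_const _) hcenter, integral_div,
          integral_sub hInt (integrable_const m), ← hm_def]
        simp
end

section
/- Let h > 0, i > 0, a ≥ 0 and k ≥ 0 be real constants. Then the function (μ₁, μ₂) ↦ (1/2)·log₂(1 + (h·i·μ₁·μ₂)/(a·i·μ₂ + k·μ₁ + 1)) tends to ∞ (atTop) along the filter atTop ×ˢ atTop (i.e., as μ₁ → ∞ and μ₂ → ∞ simultaneously). -/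
open Filter

/-- For arguments at least one, the end-to-end signal-to-noise ratio dominates a fixed multiple of
the smaller argument. -/
lemma mul_min_le_mul_div_affine {g b k x y : ℝ} (hg : 0 ≤ g) (hb : 0 ≤ b) (hk : 0 ≤ k)
    (hx : 1 ≤ x) (hy : 1 ≤ y) :
    g / (b + k + 1) * min x y ≤ g * x * y / (b * y + k * x + 1) := by
  have h_den : 0 < b * y + k * x + 1 := by positivity
  have h_sum : 0 < b + k + 1 := by positivity
  rw [div_mul_eq_mul_div, div_le_div_iff₀ h_sum h_den]
  have h_left : min x y * (b * y) ≤ x * (b * y) := by gcongr; exact min_le_left x y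
  have h_right : min x y * (k * x) ≤ y * (k * x) := by gcongr; exact min_le_right x y
  have h_one : min x y ≤ x * y := (min_le_left x y).trans (by nlinarith)
  have h_key : min x y * (b * y + k * x + 1) ≤ x * y * (b + k + 1) := by nlinarith
  calc g * min x y * (b * y + k * x + 1) = g * (min x y * (b * y + k * x + 1)) := by ring
    _ ≤ g * (x * y * (b + k + 1)) := by gcongr
    _ = g * x * y * (b + k + 1) := by ring

theorem ideal_capacity_tendsto_atTop (h i a k : ℝ) (hh : 0 < h) (hi : 0 < i)
    (ha : 0 ≤ a) (hk : 0 ≤ k) :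
    Tendsto
      (fun p : ℝ × ℝ =>
        (1 / 2) * Real.logb 2 (1 + h * i * p.1 * p.2 / (a * i * p.2 + k * p.1 + 1)))
      (atTop ×ˢ atTop) atTop := by
  have h_min : Tendsto (fun p : ℝ × ℝ => min p.1 p.2) (atTop ×ˢ atTop) atTop := by
    refine tendsto_atTop.2 fun c => ?_
    filter_upwards [prod_mem_prod (Ici_mem_atTop c) (Ici_mem_atTop c)] with p hp
    exact le_min hp.1 hp.2
  have h_snr : Tendsto
      (fun p : ℝ × ℝ => h * i * p.1 * p.2 / (a * i * p.2 + k * p.1 + 1))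
      (atTop ×ˢ atTop) atTop := by
    have h_pos : 0 < h * i / (a * i + k + 1) := by positivity
    refine tendsto_atTop_mono' _ ?_ (h_min.const_mul_atTop h_pos)
    filter_upwards [prod_mem_prod (Ici_mem_atTop (1 : ℝ)) (Ici_mem_atTop (1 : ℝ))] with p hp
    exact mul_min_le_mul_div_affine (by positivity) (by positivity) hk hp.1 hp.2
  exact ((Real.tendsto_logb_atTop one_lt_two).comp
    (tendsto_atTop_add_const_left _ 1 h_snr)).const_mul_atTop one_half_pos
end
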